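/- arXiv:1907.11419 — 2 statements merged into one kernel-verified Lean document; each statement's English description precedes it below -/
import Mathlib

section
/- If A is a π-inductive algebra, then the dimension of A as a complex vector space is at most q − 1. -/
open scoped BigOperators

namespace AffineInductive

variable {k : Type*} [Field k]

/-- The operator `π(a,b)` on functions `kˣ → ℂ`:
`(π(a,b)F)(a') = χ(a'·b) · F(a'·a)`. -/
noncomputable def piRep (χ : AddChar k ℂ) (a : kˣ) (b : k) :
    (kˣ → ℂ) ≃ₗ[ℂ] (kˣ → ℂ) where
  toFun F := fun a' => χ ((a' : k) * b) * F (a' * a)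
  map_add' F G := by funext a'; simp [mul_add]
  map_smul' c F := by funext a'; simp [smul_eq_mul]; ring
  invFun G := fun x => χ (-(((x * a⁻¹ : kˣ) : k) * b)) * G (x * a⁻¹)
  left_inv F := by
    funext x
    have h : χ (-(((x * a⁻¹ : kˣ) : k) * b)) * χ (((x * a⁻¹ : kˣ) : k) * b) = 1 := by
      rw [← AddChar.map_add_eq_mul]; simp
    simp only []
    rw [← mul_assoc, h, one_mul, inv_mul_cancel_right]
  right_inv G := by
    funext a'
    have h : χ (((a' : k)) * b) * χ (-(((a' * a * a⁻¹ : kˣ) : k) * b)) = 1 := by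
      rw [← AddChar.map_add_eq_mul]; simp
    simp only []
    rw [← mul_assoc, h, one_mul, mul_inv_cancel_right]

/-- The multiplication operator `m_φ`. -/
def mulOp (φ : kˣ → ℂ) : Module.End ℂ (kˣ → ℂ) where
  toFun F := fun a' => φ a' * F a'
  map_add' F G := by funext a'; simp [mul_add]
  map_smul' c F := by funext a'; simp [smul_eq_mul]; ring

/-- A `π`-inductive algebra: a commutative subalgebra of `End(H)` stable under
conjugation by every `π(a,b)`. -/
def IsInductive (χ : AddChar k ℂ) (A : Subalgebra ℂ (Module.End ℂ (kˣ → ℂ))) : Prop :=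
  (∀ T ∈ A, ∀ S ∈ A, T * S = S * T) ∧
  ∀ T ∈ A, ∀ (a : kˣ) (b : k),
    (piRep χ a b).toLinearMap * T * (piRep χ a b).symm.toLinearMap ∈ A

/-- The weight space `A_b = {T ∈ A | π(1,b') T π(1,b')⁻¹ = χ(b·b') T for all b'}`. -/
noncomputable def weightSpace (χ : AddChar k ℂ)
    (A : Subalgebra ℂ (Module.End ℂ (kˣ → ℂ))) (b : k) :
    Submodule ℂ (Module.End ℂ (kˣ → ℂ)) where
  carrier := {T | T ∈ A ∧ ∀ b' : k,
    (piRep χ 1 b').toLinearMap * T * (piRep χ 1 b').symm.toLinearMap = χ (b * b') • T}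
  add_mem' := by
    rintro T S ⟨hTA, hT⟩ ⟨hSA, hS⟩
    refine ⟨add_mem hTA hSA, fun b' => ?_⟩
    rw [mul_add, add_mul, hT b', hS b', smul_add]
  zero_mem' := ⟨zero_mem A, fun b' => by simp⟩
  smul_mem' := by
    rintro c T ⟨hTA, hT⟩
    refine ⟨A.smul_mem hTA c, fun b' => ?_⟩
    rw [mul_smul_comm, smul_mul_assoc, hT b', smul_comm]

/-- The inner product on `H`. -/
noncomputable def inn [Fintype k] [DecidableEq k] (F G : kˣ → ℂ) : ℂ :=
  ∑ a' : kˣ, F a' * (starRingEnd ℂ) (G a')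

theorem piRep_apply (χ : AddChar k ℂ) (a : kˣ) (b : k) (F : kˣ → ℂ) (x : kˣ) :
    piRep χ a b F x = χ ((x : k) * b) * F (x * a) := rfl

theorem piRep_symm (χ : AddChar k ℂ) (a : kˣ) (b : k) :
    (piRep χ a b).symm = piRep χ a⁻¹ (-((a⁻¹ : kˣ) : k) * b) := by
  ext1 F
  rw [LinearEquiv.symm_apply_eq]
  funext x
  have h : χ ((x : k) * b) * χ (((x * a : kˣ) : k) * (-((a⁻¹ : kˣ) : k) * b)) = 1 := by
    rw [← AddChar.map_add_eq_mul, ← AddChar.map_zero_eq_one χ]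
    congr 1
    push_cast
    field_simp
    ring
  rw [piRep_apply, piRep_apply, ← mul_assoc, h, one_mul, mul_inv_cancel_right]

/-- The representation `π` is irreducible. -/
theorem eq_top_of_piRep_mem [Fintype k] {χ : AddChar k ℂ} (hχ : χ ≠ 1)
    {W : Submodule ℂ (kˣ → ℂ)} (hW : W ≠ ⊥)
    (h : ∀ (a : kˣ) (b : k), ∀ F ∈ W, piRep χ a b F ∈ W) : W = ⊤ := by
  classical
  obtain ⟨F, hF, hF0⟩ := W.ne_bot_iff.mp hW
  obtain ⟨x₀, hx₀⟩ := Function.ne_iff.mp hF0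
  have hδ : (Pi.single x₀ 1 : kˣ → ℂ) ∈ W := by
    have hsum : ∑ b : k, χ (-((x₀ : k) * b)) • piRep χ 1 b F ∈ W :=
      W.sum_mem fun b _ => W.smul_mem _ (h 1 b F hF)
    have heq : ∑ b : k, χ (-((x₀ : k) * b)) • piRep χ 1 b F
        = ((Fintype.card k : ℂ) * F x₀) • (Pi.single x₀ 1 : kˣ → ℂ) := by
      funext x
      have key : ∀ b : k, χ (-((x₀ : k) * b)) * (χ ((x : k) * b) * F x)
          = χ (b * ((x : k) - x₀)) * F x := by
        intro b
        rw [← mul_assoc, ← AddChar.map_add_eq_mul]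
        congr 2
        ring
      simp only [Finset.sum_apply, Pi.smul_apply, smul_eq_mul, piRep_apply, mul_one, key]
      rw [← Finset.sum_mul, AddChar.sum_mulShift _ (AddChar.IsPrimitive.of_ne_one hχ)]
      by_cases hx : x = x₀
      · subst hx; simp
      · have : (x : k) - x₀ ≠ 0 := sub_ne_zero.mpr fun e => hx (Units.ext e)
        simp [hx, this]
    rw [heq] at hsum
    exact (W.smul_mem_iff
      (mul_ne_zero (Nat.cast_ne_zero.mpr Fintype.card_ne_zero) hx₀)).mp hsum
  have hsingle : ∀ y : kˣ, (Pi.single y 1 : kˣ → ℂ) ∈ W := by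
    intro y
    have := h (y⁻¹ * x₀) 0 _ hδ
    convert this using 1
    funext x
    have hxy : x * (y⁻¹ * x₀) = x₀ ↔ x = y := by
      rw [← mul_assoc, mul_eq_right, mul_inv_eq_one]
    simp [piRep_apply, Pi.single_apply, hxy]
  rw [eq_top_iff]
  intro G _
  rw [pi_eq_sum_univ' G]
  exact W.sum_mem fun y _ => W.smul_mem _ (hsingle y)

/-- A vector that is mapped to a multiple of itself by every operator of `A`. -/
def IsJointEigenvector {V : Type*} [AddCommGroup V] [Module ℂ V]
    (A : Subalgebra ℂ (Module.End ℂ V)) (v : V) : Prop :=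
  ∀ T ∈ A, ∃ c : ℂ, T v = c • v

theorem exists_isJointEigenvector {V : Type*} [AddCommGroup V] [Module ℂ V]
    [FiniteDimensional ℂ V] [Nontrivial V] (A : Subalgebra ℂ (Module.End ℂ V))
    (hA : ∀ T ∈ A, ∀ S ∈ A, T * S = S * T) :
    ∃ v : V, v ≠ 0 ∧ IsJointEigenvector A v := by
  obtain ⟨W, ⟨hW0, hWA⟩, hmin⟩ := (wellFounded_lt (α := Submodule ℂ V)).has_min
    {W | W ≠ ⊥ ∧ ∀ T ∈ A, ∀ v ∈ W, T v ∈ W} ⟨⊤, top_ne_bot, fun _ _ _ _ => trivial⟩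
  obtain ⟨v, hv, hv0⟩ := W.ne_bot_iff.mp hW0
  refine ⟨v, hv0, fun T hT => ?_⟩
  have : Nontrivial W := (Submodule.nontrivial_iff_ne_bot).mpr hW0
  obtain ⟨c, hc⟩ := Module.End.exists_eigenvalue (T.restrict (hWA T hT))
  obtain ⟨w, hw⟩ := hc.exists_hasEigenvector
  have hTw : T w = c • (w : V) := congrArg Subtype.val hw.apply_eq_smul
  have hU : W ⊓ Module.End.eigenspace T c ∈
      {W : Submodule ℂ V | W ≠ ⊥ ∧ ∀ T ∈ A, ∀ v ∈ W, T v ∈ W} := by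
    refine ⟨(Submodule.ne_bot_iff _).mpr ⟨w, ⟨w.2, Module.End.mem_eigenspace_iff.mpr hTw⟩,
      fun h => hw.2 (Subtype.ext h)⟩, fun S hS u hu => ⟨hWA S hS u hu.1, ?_⟩⟩
    have hTu := Module.End.mem_eigenspace_iff.mp hu.2
    rw [SetLike.mem_coe, Module.End.mem_eigenspace_iff, ← Module.End.mul_apply, hA T hT S hS,
      Module.End.mul_apply, hTu, map_smul]
  have hle : W ≤ W ⊓ Module.End.eigenspace T c :=
    (inf_le_left.eq_or_lt.resolve_right (hmin _ hU)).ge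
  exact ⟨c, Module.End.mem_eigenspace_iff.mp (hle hv).2⟩

theorem finrank_le_of_span_isJointEigenvector {V : Type*} [AddCommGroup V] [Module ℂ V]
    [FiniteDimensional ℂ V] (A : Subalgebra ℂ (Module.End ℂ V))
    (h : Submodule.span ℂ {v | IsJointEigenvector A v} = ⊤) :
    Module.finrank ℂ A ≤ Module.finrank ℂ V := by
  obtain ⟨s, hs, hspan, hli⟩ := exists_linearIndependent ℂ {v | IsJointEigenvector A v}
  let B : Module.Basis s ℂ V := Module.Basis.mk hli (by simp [hspan, h])
  have : Fintype s := FiniteDimensional.fintypeBasisIndex B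
  have hB : ∀ i, B i = i := fun i => by simp [B]
  let f : A →ₗ[ℂ] (s → ℂ) :=
    LinearMap.pi fun i => B.coord i ∘ₗ LinearMap.applyₗ (B i) ∘ₗ A.val.toLinearMap
  have hf : Function.Injective f := by
    rw [injective_iff_map_eq_zero]
    intro T hT
    refine Subtype.ext (B.ext fun i => ?_)
    obtain ⟨c, hc⟩ := hs i.2 T T.2
    rw [← hB i] at hc
    have hi : B.coord i ((T : Module.End ℂ V) (B i)) = 0 := congrFun hT i
    rw [hc] at hi
    have hc0 : c = 0 := by simpa using hi
    simp [hc, hc0]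
  calc Module.finrank ℂ A ≤ Module.finrank ℂ (s → ℂ) :=
        LinearMap.finrank_le_finrank_of_injective hf
    _ = Module.finrank ℂ V := by
      rw [Module.finrank_fintype_fun_eq_card, Module.finrank_eq_card_basis B]

theorem IsInductive.isJointEigenvector_piRep {χ : AddChar k ℂ}
    {A : Subalgebra ℂ (Module.End ℂ (kˣ → ℂ))} (hA : IsInductive χ A) (a : kˣ) (b : k)
    {F : kˣ → ℂ} (hF : IsJointEigenvector A F) : IsJointEigenvector A (piRep χ a b F) := by
  intro T hT
  have hmem := hA.2 T hT a⁻¹ (-((a⁻¹ : kˣ) : k) * b)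
  rw [← piRep_symm, LinearEquiv.symm_symm] at hmem
  obtain ⟨c, hc⟩ := hF _ hmem
  refine ⟨c, ?_⟩
  rw [← map_smul, ← LinearEquiv.symm_apply_eq]
  exact hc

/-- A `π`-inductive algebra has dimension at most `q - 1`. -/
theorem inductive_algebra_dim_le
    {k : Type*} [Field k] [Fintype k]
    (χ : AddChar k ℂ) (hχ : χ ≠ 1)
    (A : Subalgebra ℂ (Module.End ℂ (kˣ → ℂ)))
    (hA : IsInductive χ A) :
    Module.finrank ℂ A ≤ Fintype.card k - 1 := by
  classical
  have hspan : Submodule.span ℂ {v | IsJointEigenvector A v} = ⊤ := by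
    refine eq_top_of_piRep_mem hχ ?_ fun a b F hF => ?_
    · obtain ⟨v, hv0, hv⟩ := exists_isJointEigenvector A hA.1
      exact (Submodule.ne_bot_iff _).mpr ⟨v, Submodule.subset_span hv, hv0⟩
    · induction hF using Submodule.span_induction with
      | mem F hF => exact Submodule.subset_span (hA.isJointEigenvector_piRep a b hF)
      | zero => simp
      | add F G _ _ hF hG => simpa using add_mem hF hG
      | smul c F _ hF => simpa using Submodule.smul_mem _ c hF
  calc Module.finrank ℂ A ≤ Module.finrank ℂ (kˣ → ℂ) :=
        finrank_le_of_span_isJointEigenvector A hspan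
    _ = Fintype.card k - 1 := by
      rw [Module.finrank_fintype_fun_eq_card, Fintype.card_units]

end AffineInductive
end

section
/- If A is a π-inductive algebra, then A_0 ⊆ B; that is, every T ∈ A that commutes with π(1,b') for all b' ∈ k is a multiplication operator m_φ for some φ ∈ H. -/
open scoped BigOperators

namespace AffineInductive

variable {k : Type*} [Field k]

/-- A unit `x` is determined by the character `b ↦ χ (x * b)`. -/
theorem units_eq_of_addChar_mul_eq {χ : AddChar k ℂ} (hχ : χ ≠ 1) {x y : kˣ}
    (h : ∀ b : k, χ (x * b) = χ (y * b)) : x = y := by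
  by_contra hxy
  have hsub : (x : k) - y ≠ 0 := sub_ne_zero.mpr fun e => hxy (Units.ext e)
  refine AddChar.IsPrimitive.of_ne_one hχ hsub ?_
  ext b
  rw [AddChar.mulShift_apply, sub_mul, AddChar.map_sub_eq_div, h b, AddChar.one_apply,
    div_self (χ.val_isUnit _).ne_zero]

theorem piRep_one_apply (χ : AddChar k ℂ) (b : k) (F : kˣ → ℂ) (x : kˣ) :
    piRep χ 1 b F x = χ (x * b) * F x := by
  simp [piRep]

theorem piRep_one_single [DecidableEq kˣ] (χ : AddChar k ℂ) (b : k) (x : kˣ) :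
    piRep χ 1 b (Pi.single x 1) = χ (x * b) • (Pi.single x 1 : kˣ → ℂ) := by
  ext y
  rw [piRep_one_apply]
  obtain rfl | hyx := eq_or_ne y x
  · simp
  · simp [hyx]

/-- An operator commuting with all `π(1,b)` has no off-diagonal matrix coefficients. -/
theorem apply_single_eq_zero [DecidableEq kˣ] {χ : AddChar k ℂ} (hχ : χ ≠ 1)
    {T : Module.End ℂ (kˣ → ℂ)}
    (hT : ∀ b : k, (piRep χ 1 b).toLinearMap * T = T * (piRep χ 1 b).toLinearMap)
    {x y : kˣ} (hxy : y ≠ x) : T (Pi.single x 1) y = 0 := by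
  by_contra hne
  refine hxy (units_eq_of_addChar_mul_eq hχ fun b => ?_)
  have hb := congrFun (LinearMap.congr_fun (hT b) (Pi.single x 1)) y
  simp only [Module.End.mul_apply, LinearEquiv.coe_coe, piRep_one_apply, piRep_one_single,
    map_smul, Pi.smul_apply, smul_eq_mul] at hb
  exact mul_right_cancel₀ hne hb

/-- `A_0 ⊆ B`: every `T ∈ A` commuting with all `π(1,b')` is a
multiplication operator. -/
theorem weightSpace_zero_subset_mult
    {k : Type*} [Field k] [Fintype k]
    (χ : AddChar k ℂ) (hχ : χ ≠ 1)
    (A : Subalgebra ℂ (Module.End ℂ (kˣ → ℂ)))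
    (hA : IsInductive χ A) :
    ∀ T ∈ A,
      (∀ b' : k, (piRep χ 1 b').toLinearMap * T = T * (piRep χ 1 b').toLinearMap) →
        ∃ φ : kˣ → ℂ, T = mulOp φ := by
  classical
  intro T _ hT
  refine ⟨fun x => T (Pi.single x 1) x, LinearMap.pi_ext' fun x => LinearMap.ext_ring ?_⟩
  ext y
  obtain rfl | hyx := eq_or_ne y x
  · simp [mulOp]
  · simp [mulOp, apply_single_eq_zero hχ hT hyx, hyx]

end AffineInductive
end
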